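/- For every R ∈ (0,2) there exist a constant C(R) > 0 and a threshold d₀(R) such that for all d ≥ d₀(R) and all unit vectors x, y ∈ S^{d−1} with ‖x − y‖₂ = R, the cross-polytope hash h under a matrix G ∈ ℝ^{d×d} with i.i.d. N(0,1) entries satisfies | ln(1/Pr[h(x) = h(y)]) − (R²/(4 − R²))·ln d | ≤ C(R)·ln(ln d). -/

import Mathlib

open MeasureTheory ProbabilityTheory

/-- The law of a `k × m` matrix with i.i.d. standard Gaussian entries. -/
noncomputable def gaussMatrix (k m : ℕ) : Measure (Fin k → Fin m → ℝ) :=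
  Measure.pi fun _ => Measure.pi fun _ => gaussianReal 0 1

/-- `(Av)_i` for a matrix `A` given by rows and a vector `v`. -/
def mvMul {k m : ℕ} (A : Fin k → Fin m → ℝ) (v : Fin m → ℝ) (i : Fin k) : ℝ :=
  ∑ j, A i j * v j

/-- The event that `v` cross-polytope hashes to `s·e_i` under `A`, via strict inequalities. -/
def hashAt {k m : ℕ} (A : Fin k → Fin m → ℝ) (v : Fin m → ℝ) (i : Fin k) (s : ℝ) : Prop :=
  ∀ j, j ≠ i → |mvMul A v j| < s * mvMul A v i

/-- The event that `v` and `w` receive the same cross-polytope hash under `A`. -/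
def collide {k m : ℕ} (A : Fin k → Fin m → ℝ) (v w : Fin m → ℝ) : Prop :=
  ∃ (i : Fin k) (s : ℝ), (s = 1 ∨ s = -1) ∧ hashAt A v i s ∧ hashAt A w i s

/-- The collision probability of `x, y ∈ ℝ^d` under cross-polytope LSH with a `d × d`
i.i.d. standard Gaussian matrix. -/
noncomputable def collProb (d : ℕ) (x y : Fin d → ℝ) : ℝ :=
  (gaussMatrix d d {A | collide A x y}).toReal

/-- Chernoff bound for the standard Gaussian tail. -/
lemma gaussianReal_real_Ici_le {a : ℝ} (ha : 0 ≤ a) :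
    (gaussianReal 0 1).real (Set.Ici a) ≤ Real.exp (-a ^ 2 / 2) := by
  have h := measure_ge_le_exp_mul_mgf (μ := gaussianReal 0 1) (X := id) a ha
    (integrable_exp_mul_gaussianReal a)
  rw [mgf_id_gaussianReal, ← Real.exp_add] at h
  refine h.trans (Real.exp_le_exp.2 ?_)
  simp only [NNReal.coe_one]
  linarith [sq a]

/-- Lower bound for the standard Gaussian mass of an interval on the positive half-line. -/
lemma le_gaussianReal_real_Icc {a b : ℝ} (ha : 0 ≤ a) (hab : a ≤ b) :
    (b - a) * ((√(2 * Real.pi))⁻¹ * Real.exp (-b ^ 2 / 2)) ≤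
      (gaussianReal 0 1).real (Set.Icc a b) := by
  rw [Measure.real, gaussianReal_apply_eq_integral 0 one_ne_zero,
    ENNReal.toReal_ofReal (setIntegral_nonneg measurableSet_Icc
      fun x _ => gaussianPDFReal_nonneg 0 1 x)]
  have h := setIntegral_mono_on (μ := volume) (s := Set.Icc a b)
    (f := fun _ => (√(2 * Real.pi))⁻¹ * Real.exp (-b ^ 2 / 2)) (g := gaussianPDFReal 0 1)
    (integrableOn_const (by simp)) (integrable_gaussianPDFReal 0 1).integrableOn
    measurableSet_Icc
    (fun x hx => by
      simp only [gaussianPDFReal, NNReal.coe_one, mul_one, sub_zero]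
      have : x ^ 2 ≤ b ^ 2 := pow_le_pow_left₀ (ha.trans hx.1) hx.2 2
      gcongr)
  simpa [hab] using h

lemma map_inner_stdGaussian {E : Type*} [NormedAddCommGroup E] [InnerProductSpace ℝ E]
    [FiniteDimensional ℝ E] [MeasurableSpace E] [BorelSpace E] {w : E} (hw : ‖w‖ = 1) :
    (stdGaussian E).map (fun z => inner ℝ w z) = gaussianReal 0 1 := by
  have hg : HasGaussianLaw (fun z : E => inner ℝ w z) (stdGaussian E) :=
    (IsGaussian.hasGaussianLaw_id (μ := stdGaussian E)).map (innerSL ℝ w)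
  rw [hg.map_eq_gaussianReal, ← covarianceBilin_self IsGaussian.memLp_two_id,
    covarianceBilin_stdGaussian, innerSL_apply_apply, real_inner_self_eq_norm_sq, hw]
  have := integral_strongDual_stdGaussian (innerSL ℝ w)
  simp only [innerSL_apply_apply] at this
  simp [this]

/-- Projections of a standard Gaussian vector on two orthonormal vectors are independent standard
Gaussians. -/
lemma map_inner_prodMk_stdGaussian {E : Type*} [NormedAddCommGroup E] [InnerProductSpace ℝ E]
    [FiniteDimensional ℝ E] [MeasurableSpace E] [BorelSpace E] {u v : E}
    (hu : ‖u‖ = 1) (hv : ‖v‖ = 1) (huv : inner ℝ u v = 0) :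
    (stdGaussian E).map (fun z => (inner ℝ u z, inner ℝ v z)) =
      (gaussianReal 0 1).prod (gaussianReal 0 1) := by
  have hg : HasGaussianLaw (fun z : E => (inner ℝ u z, inner ℝ v z)) (stdGaussian E) :=
    (IsGaussian.hasGaussianLaw_id (μ := stdGaussian E)).map ((innerSL ℝ u).prod (innerSL ℝ v))
  have hi := hg.indepFun_of_covariance_eq_zero (by
    rw [← covarianceBilin_apply_eq_cov IsGaussian.memLp_two_id, covarianceBilin_stdGaussian,
      innerSL_apply_apply, huv])
  rw [indepFun_iff_map_prod_eq_prod_map_map (by fun_prop) (by fun_prop),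
    map_inner_stdGaussian hu, map_inner_stdGaussian hv] at hi
  exact hi

lemma norm_add_sq_of_norm_sub {E : Type*} [NormedAddCommGroup E] [InnerProductSpace ℝ E]
    {x y : E} {R : ℝ} (hx : ‖x‖ = 1) (hy : ‖y‖ = 1) (hxy : ‖x - y‖ = R) :
    ‖x + y‖ ^ 2 = 4 - R ^ 2 := by
  have := parallelogram_law_with_norm ℝ x y
  rw [hx, hy, hxy] at this
  linarith

section StdGaussian

variable {E : Type*} [NormedAddCommGroup E] [InnerProductSpace ℝ E]
  [FiniteDimensional ℝ E] [MeasurableSpace E] [BorelSpace E]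

lemma stdGaussian_real_le_inner_le {w : E} (hw : ‖w‖ = 1) {t : ℝ} (ht : 0 ≤ t) :
    (stdGaussian E).real {z | t ≤ inner ℝ w z} ≤ Real.exp (-t ^ 2 / 2) := by
  refine le_trans (le_of_eq ?_) (gaussianReal_real_Ici_le ht)
  rw [← map_inner_stdGaussian hw, map_measureReal_apply (by fun_prop) measurableSet_Ici]
  rfl

lemma stdGaussian_real_le_abs_inner_le {w : E} (hw : ‖w‖ = 1) {t : ℝ} (ht : 0 ≤ t) :
    (stdGaussian E).real {z | t ≤ |inner ℝ w z|} ≤ 2 * Real.exp (-t ^ 2 / 2) := by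
  have h1 := stdGaussian_real_le_inner_le hw ht
  have h2 := stdGaussian_real_le_inner_le (w := -w) (by rwa [norm_neg]) ht
  have h3 : {z : E | t ≤ |inner ℝ w z|} ⊆
      {z | t ≤ inner ℝ w z} ∪ {z | t ≤ inner ℝ (-w) z} := by
    intro z hz
    simpa [inner_neg_left, le_abs] using hz
  linarith [measureReal_mono (μ := stdGaussian E) h3,
    measureReal_union_le (μ := stdGaussian E) {z : E | t ≤ inner ℝ w z}
      {z | t ≤ inner ℝ (-w) z}]

lemma le_stdGaussian_real_le_abs_inner {w : E} (hw : ‖w‖ = 1) {t : ℝ} (ht : 0 < t) :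
    t⁻¹ * ((√(2 * Real.pi))⁻¹ * Real.exp (-(t + t⁻¹) ^ 2 / 2)) ≤
      (stdGaussian E).real {z | t ≤ |inner ℝ w z|} := by
  have h := le_gaussianReal_real_Icc ht.le (le_add_of_nonneg_right (inv_nonneg.2 ht.le))
  rw [add_sub_cancel_left, ← map_inner_stdGaussian hw,
    map_measureReal_apply (by fun_prop) measurableSet_Icc] at h
  exact h.trans (measureReal_mono fun z hz => hz.1.trans (le_abs_self _))

variable {x y : E} {R : ℝ}

lemma stdGaussian_real_le_inner_and_le (hx : ‖x‖ = 1) (hy : ‖y‖ = 1) (hxy : ‖x - y‖ = R)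
    (hR : R ^ 2 < 4) {t : ℝ} (ht : 0 ≤ t) :
    (stdGaussian E).real {z | t ≤ inner ℝ x z ∧ t ≤ inner ℝ y z} ≤
      Real.exp (-2 * t ^ 2 / (4 - R ^ 2)) := by
  have hs := norm_add_sq_of_norm_sub hx hy hxy
  have hs0 : 0 < ‖x + y‖ := by
    refine (norm_nonneg _).lt_of_ne fun h => ?_
    rw [← h] at hs
    linarith
  have h1 := stdGaussian_real_le_inner_le (w := ‖x + y‖⁻¹ • (x + y))
    (by rw [norm_smul, norm_inv, norm_norm, inv_mul_cancel₀ hs0.ne'])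
    (t := ‖x + y‖⁻¹ * (2 * t)) (by positivity)
  have h2 : -(‖x + y‖⁻¹ * (2 * t)) ^ 2 / 2 = -2 * t ^ 2 / (4 - R ^ 2) := by
    rw [← hs]; field_simp
  rw [h2] at h1
  refine (measureReal_mono fun z hz => ?_).trans h1
  simp only [Set.mem_ofPred_eq, inner_smul_left, inner_add_left, RCLike.conj_to_real] at hz ⊢
  gcongr
  linarith

lemma le_stdGaussian_real_le_inner_and_le (hx : ‖x‖ = 1) (hy : ‖y‖ = 1) (hxy : ‖x - y‖ = R)
    (hR0 : 0 < R) (hR : R ^ 2 < 4) {t : ℝ} (ht : 0 < t) :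
    (t⁻¹ * ((√(2 * Real.pi))⁻¹ *
        Real.exp (-((2 * t + R * t⁻¹) / √(4 - R ^ 2) + t⁻¹) ^ 2 / 2))) *
      (t⁻¹ * ((√(2 * Real.pi))⁻¹ * Real.exp (-(t⁻¹) ^ 2 / 2))) ≤
      (stdGaussian E).real {z | t ≤ inner ℝ x z ∧ t ≤ inner ℝ y z} := by
  set s := √(4 - R ^ 2) with hs
  have hs0 : 0 < s := Real.sqrt_pos.2 (by linarith)
  have hsn : ‖x + y‖ = s := by
    rw [hs, ← norm_add_sq_of_norm_sub hx hy hxy, Real.sqrt_sq (norm_nonneg _)]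
  have ht' : 0 < t⁻¹ := inv_pos.2 ht
  have hprod := map_inner_prodMk_stdGaussian (u := s⁻¹ • (x + y)) (v := R⁻¹ • (x - y))
    (by rw [norm_smul, hsn, norm_inv, Real.norm_of_nonneg hs0.le, inv_mul_cancel₀ hs0.ne'])
    (by rw [norm_smul, hxy, norm_inv, Real.norm_of_nonneg hR0.le, inv_mul_cancel₀ hR0.ne'])
    (by
      rw [inner_smul_left, inner_smul_right, (real_inner_add_sub_eq_zero_iff x y).2 (by rw [hx, hy])]
      simp)
  set a := (2 * t + R * t⁻¹) / s with ha
  have ha0 : 0 ≤ a := by positivity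
  have h1 := le_gaussianReal_real_Icc ha0 (le_add_of_nonneg_right ht'.le)
  have h2 := le_gaussianReal_real_Icc le_rfl ht'.le
  rw [add_sub_cancel_left] at h1
  rw [sub_zero] at h2
  have h3 := mul_le_mul h1 h2 (by positivity) measureReal_nonneg
  rw [← measureReal_prod_prod, ← hprod, map_measureReal_apply (by fun_prop)
    (measurableSet_Icc.prod measurableSet_Icc)] at h3
  refine h3.trans (measureReal_mono fun z hz => ?_)
  simp only [Set.mem_preimage, Set.mem_prod, Set.mem_Icc, inner_smul_left, inner_add_left,
    inner_sub_left, RCLike.conj_to_real] at hz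
  obtain ⟨⟨hz1, -⟩, hz2, hz3⟩ := hz
  rw [ha, div_le_iff₀ hs0, mul_right_comm, inv_mul_cancel₀ hs0.ne', one_mul] at hz1
  have hz2' : 0 ≤ inner ℝ x z - inner ℝ y z := by
    by_contra! h
    exact absurd hz2 (not_le.2 (mul_neg_of_pos_of_neg (inv_pos.2 hR0) h))
  rw [inv_mul_le_iff₀ hR0] at hz3
  constructor <;> linarith

end StdGaussian

lemma measurableSet_le_inner_and_le {E : Type*} [NormedAddCommGroup E] [InnerProductSpace ℝ E]
    [MeasurableSpace E] [OpensMeasurableSpace E] (v w : E) (t : ℝ) :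
    MeasurableSet {z | t ≤ inner ℝ v z ∧ t ≤ inner ℝ w z} := by
  rw [Set.ofPred_and]
  refine MeasurableSet.inter ?_ ?_ <;> exact (isClosed_le (by fun_prop) (by fun_prop)).measurableSet

instance isProbabilityMeasure_gaussMatrix (k m : ℕ) : IsProbabilityMeasure (gaussMatrix k m) := by
  unfold gaussMatrix; infer_instance

/-- Events that constrain each row separately factor under the Gaussian matrix law. -/
lemma gaussMatrix_real_forall {k m : ℕ} {S : Fin k → Set (EuclideanSpace ℝ (Fin m))}
    (hS : ∀ i, MeasurableSet (S i)) :
    (gaussMatrix k m).real {A | ∀ i, WithLp.toLp 2 (A i) ∈ S i} =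
      ∏ i, (stdGaussian (EuclideanSpace ℝ (Fin m))).real (S i) := by
  have h : {A : Fin k → Fin m → ℝ | ∀ i, WithLp.toLp 2 (A i) ∈ S i} =
      Set.univ.pi fun i => WithLp.toLp 2 ⁻¹' S i := by
    ext A; simp
  rw [h, gaussMatrix, Measure.real, Measure.pi_pi, ENNReal.toReal_prod]
  refine Finset.prod_congr rfl fun i _ => ?_
  rw [← map_pi_eq_stdGaussian, map_measureReal_apply (by fun_prop) (hS i)]
  rfl

lemma gaussMatrix_real_row {k m : ℕ} {S : Set (EuclideanSpace ℝ (Fin m))}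
    (hS : MeasurableSet S) (i : Fin k) :
    (gaussMatrix k m).real {A | WithLp.toLp 2 (A i) ∈ S} =
      (stdGaussian (EuclideanSpace ℝ (Fin m))).real S := by
  have h := gaussMatrix_real_forall (k := k) (m := m)
    (S := fun j => if j = i then S else Set.univ)
    (fun j => by split_ifs <;> [exact hS; exact MeasurableSet.univ])
  rw [Finset.prod_eq_single i (fun j _ hj => by simp [hj]) (by simp)] at h
  simp only [if_true] at h
  rw [← h]
  congr 1
  ext A
  constructor
  · intro hA j
    by_cases hj : j = i
    · subst hj; simpa using hA
    · simp [hj]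
  · intro hA
    simpa using hA i

lemma mvMul_eq_inner {k m : ℕ} (A : Fin k → Fin m → ℝ) (v : EuclideanSpace ℝ (Fin m))
    (i : Fin k) : mvMul A (fun j => v j) i = inner ℝ v (WithLp.toLp 2 (A i)) := by
  simp [mvMul, PiLp.inner_apply]

section Collision

variable {d : ℕ} {x y : EuclideanSpace ℝ (Fin d)} {R t : ℝ}

/-- All coordinates of `Gx` are small with small probability. -/
lemma gaussMatrix_real_forall_abs_lt_le (hx : ‖x‖ = 1) (ht : 0 < t) :
    (gaussMatrix d d).real {A | ∀ i, |mvMul A (fun j => x j) i| < t} ≤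
      Real.exp (-(d * (t⁻¹ * ((√(2 * Real.pi))⁻¹ * Real.exp (-(t + t⁻¹) ^ 2 / 2))))) := by
  have hm : MeasurableSet {z : EuclideanSpace ℝ (Fin d) | t ≤ |inner ℝ x z|} :=
    measurableSet_le (by fun_prop) (by fun_prop)
  have h := gaussMatrix_real_forall (k := d) (fun _ => hm.compl)
  rw [Finset.prod_const, Finset.card_univ, Fintype.card_fin, probReal_compl_eq_one_sub hm] at h
  have hset : {A : Fin d → Fin d → ℝ | ∀ i, |mvMul A (fun j => x j) i| < t} =
      {A | ∀ i, WithLp.toLp 2 (A i) ∈ {z : EuclideanSpace ℝ (Fin d) | t ≤ |inner ℝ x z|}ᶜ} := by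
    ext A
    simp [mvMul_eq_inner]
  rw [hset, h, ← mul_neg, Real.exp_nat_mul]
  refine pow_le_pow_left₀ (sub_nonneg.2 measureReal_le_one) ?_ d
  exact (sub_le_sub_left (le_stdGaussian_real_le_abs_inner hx ht) 1).trans
    (by linarith [Real.add_one_le_exp (-(t⁻¹ * ((√(2 * Real.pi))⁻¹ *
      Real.exp (-(t + t⁻¹) ^ 2 / 2))))])

lemma collProb_le (hd : 2 ≤ d) (hx : ‖x‖ = 1) (hy : ‖y‖ = 1) (hxy : ‖x - y‖ = R) (hR : R ^ 2 < 4)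
    (ht : 0 < t) :
    collProb d (fun i => x i) (fun i => y i) ≤
      2 * Real.exp (-(d * (t⁻¹ * ((√(2 * Real.pi))⁻¹ * Real.exp (-(t + t⁻¹) ^ 2 / 2))))) +
        d * (2 * Real.exp (-2 * t ^ 2 / (4 - R ^ 2))) := by
  have : Nontrivial (Fin d) := Fin.nontrivial_iff_two_le.2 hd
  let Q (v w : EuclideanSpace ℝ (Fin d)) : Set (EuclideanSpace ℝ (Fin d)) :=
    {z | t ≤ inner ℝ v z ∧ t ≤ inner ℝ w z}
  have hQm : ∀ v w, MeasurableSet (Q v w) := fun v w =>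
    measurableSet_le_inner_and_le v w t
  let T (v : EuclideanSpace ℝ (Fin d)) : Set (Fin d → Fin d → ℝ) :=
    {A | ∀ i, |mvMul A (fun j => v j) i| < t}
  let B : Set (Fin d → Fin d → ℝ) :=
    ⋃ i : Fin d, ({A | WithLp.toLp 2 (A i) ∈ Q x y} ∪ {A | WithLp.toLp 2 (A i) ∈ Q (-x) (-y)})
  have hB : (gaussMatrix d d).real B ≤ d * (2 * Real.exp (-2 * t ^ 2 / (4 - R ^ 2))) := by
    refine (measureReal_iUnion_fintype_le _).trans ?_
    refine (Finset.sum_le_card_nsmul _ _ (2 * Real.exp (-2 * t ^ 2 / (4 - R ^ 2)))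
      fun i _ => ?_).trans (by simp)
    refine (measureReal_union_le _ _).trans ?_
    rw [gaussMatrix_real_row (hQm _ _), gaussMatrix_real_row (hQm _ _), two_mul]
    refine add_le_add (stdGaussian_real_le_inner_and_le hx hy hxy hR ht.le)
      (stdGaussian_real_le_inner_and_le (by rwa [norm_neg]) (by rwa [norm_neg]) ?_ hR ht.le)
    rw [← neg_sub', norm_neg, hxy]
  have hmax : ∀ (v : EuclideanSpace ℝ (Fin d)) (A : Fin d → Fin d → ℝ) (i : Fin d) (s : ℝ),
      (s = 1 ∨ s = -1) → hashAt A (fun j => v j) i s →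
      s * mvMul A (fun j => v j) i < t → A ∈ T v := by
    intro v A i s hs h hlt j
    by_cases hj : j = i
    · subst hj
      obtain ⟨k, hk⟩ := exists_ne j
      have h0 := (abs_nonneg _).trans_lt (h k hk)
      have : |mvMul A (fun j => v j) j| = |s * mvMul A (fun j => v j) j| := by
        rcases hs with rfl | rfl <;> simp
      rwa [this, abs_of_pos h0]
    · exact (h j hj).trans hlt
  have hsub : {A | collide A (fun i => x i) (fun i => y i)} ⊆ (T x ∪ T y) ∪ B := by
    rintro A ⟨i, s, hs, hX, hY⟩
    by_cases h1 : s * mvMul A (fun j => x j) i < t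
    · exact Or.inl (Or.inl (hmax x A i s hs hX h1))
    by_cases h2 : s * mvMul A (fun j => y j) i < t
    · exact Or.inl (Or.inr (hmax y A i s hs hY h2))
    refine Or.inr (Set.mem_iUnion.2 ⟨i, ?_⟩)
    rw [mvMul_eq_inner, not_lt] at h1 h2
    rcases hs with rfl | rfl
    · exact Or.inl ⟨by simpa using h1, by simpa using h2⟩
    · exact Or.inr ⟨by simpa [inner_neg_left] using h1, by simpa [inner_neg_left] using h2⟩
  have hTx := gaussMatrix_real_forall_abs_lt_le hx ht
  have hTy := gaussMatrix_real_forall_abs_lt_le hy ht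
  have hm := measureReal_mono (μ := gaussMatrix d d) hsub
  have hu1 := measureReal_union_le (μ := gaussMatrix d d) (T x ∪ T y) B
  have hu2 := measureReal_union_le (μ := gaussMatrix d d) (T x) (T y)
  change (gaussMatrix d d).real {A | collide A (fun i => x i) (fun i => y i)} ≤ _
  linarith

lemma le_collProb (hx : ‖x‖ = 1) (hy : ‖y‖ = 1) (hxy : ‖x - y‖ = R)
    (hR0 : 0 < R) (hR : R ^ 2 < 4) (ht : 0 < t) (htd : 8 * d * Real.exp (-t ^ 2 / 2) ≤ 1) :
    d * ((t⁻¹ * ((√(2 * Real.pi))⁻¹ *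
        Real.exp (-((2 * t + R * t⁻¹) / √(4 - R ^ 2) + t⁻¹) ^ 2 / 2))) *
      (t⁻¹ * ((√(2 * Real.pi))⁻¹ * Real.exp (-(t⁻¹) ^ 2 / 2)))) * 2⁻¹ ≤
      collProb d (fun i => x i) (fun i => y i) := by
  set q := (t⁻¹ * ((√(2 * Real.pi))⁻¹ *
        Real.exp (-((2 * t + R * t⁻¹) / √(4 - R ^ 2) + t⁻¹) ^ 2 / 2))) *
      (t⁻¹ * ((√(2 * Real.pi))⁻¹ * Real.exp (-(t⁻¹) ^ 2 / 2)))
  let Q : Set (EuclideanSpace ℝ (Fin d)) := {z | t ≤ inner ℝ x z ∧ t ≤ inner ℝ y z}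
  let F : Set (EuclideanSpace ℝ (Fin d)) :=
    ({z | t ≤ |inner ℝ x z|} ∪ {z | t ≤ |inner ℝ y z|})ᶜ
  have hQm : MeasurableSet Q := measurableSet_le_inner_and_le x y t
  have hFm' : MeasurableSet ({z : EuclideanSpace ℝ (Fin d) | t ≤ |inner ℝ x z|} ∪
      {z | t ≤ |inner ℝ y z|}) := (measurableSet_le (by fun_prop) (by fun_prop)).union
      (measurableSet_le (by fun_prop) (by fun_prop))
  have hFm : MeasurableSet F := hFm'.compl
  let P : Measure (EuclideanSpace ℝ (Fin d)) := stdGaussian _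
  have hF : 1 - 4 * Real.exp (-t ^ 2 / 2) ≤ P.real F := by
    rw [probReal_compl_eq_one_sub hFm']
    have := measureReal_union_le (μ := P) {z : EuclideanSpace ℝ (Fin d) | t ≤ |inner ℝ x z|}
      {z | t ≤ |inner ℝ y z|}
    linarith [stdGaussian_real_le_abs_inner_le hx ht.le,
      stdGaussian_real_le_abs_inner_le hy ht.le]
  let S (i j : Fin d) : Set (EuclideanSpace ℝ (Fin d)) := if j = i then Q else F
  let D (i : Fin d) : Set (Fin d → Fin d → ℝ) := {A | ∀ j, WithLp.toLp 2 (A j) ∈ S i j}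
  have hSm : ∀ i j, MeasurableSet (S i j) := fun i j => by
    simp only [S]; split_ifs <;> [exact hQm; exact hFm]
  have hD : ∀ i, q * 2⁻¹ ≤ (gaussMatrix d d).real (D i) := by
    intro i
    rw [gaussMatrix_real_forall (hSm i), ← Finset.mul_prod_erase _ _ (Finset.mem_univ i)]
    have hrest : ∏ j ∈ Finset.univ.erase i, P.real (S i j) = P.real F ^ (d - 1) := by
      rw [Finset.prod_congr rfl (g := fun _ => P.real F) fun j hj => by
        simp [S, Finset.ne_of_mem_erase hj]]
      simp
    have hd : (1 : ℝ) ≤ d := by exact_mod_cast i.pos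
    have hpow : 2⁻¹ ≤ P.real F ^ (d - 1) := by
      have hε : 4 * Real.exp (-t ^ 2 / 2) ≤ 1 := by
        nlinarith [Real.exp_pos (-t ^ 2 / 2)]
      have hb := one_add_mul_le_pow (a := -(4 * Real.exp (-t ^ 2 / 2))) (by linarith) (d - 1)
      refine le_trans ?_ (pow_le_pow_left₀ (by linarith) hF _)
      rw [sub_eq_add_neg]
      refine le_trans ?_ hb
      have : ((d - 1 : ℕ) : ℝ) ≤ d := by exact_mod_cast Nat.sub_le d 1
      nlinarith [Real.exp_pos (-t ^ 2 / 2)]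
    rw [hrest]
    simp only [S, if_true]
    exact mul_le_mul (le_stdGaussian_real_le_inner_and_le hx hy hxy hR0 hR ht) hpow
      (by norm_num) measureReal_nonneg
  have hDm : ∀ i, MeasurableSet (D i) := by
    intro i
    simp only [D, Set.ofPred_forall]
    exact MeasurableSet.iInter fun j => (hSm i j).preimage (by fun_prop)
  have hQF : ∀ z ∈ Q, z ∉ F := fun z hz hz' => hz' (Or.inl (hz.1.trans (le_abs_self _)))
  have hdisj : Pairwise (Function.onFun Disjoint D) := by
    intro i j hij
    refine Set.disjoint_left.2 fun A hi hj => ?_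
    have h1 := hi i
    have h2 := hj i
    simp only [S, if_true, if_neg hij] at h1 h2
    exact hQF _ h1 h2
  have hsub : (⋃ i, D i) ⊆ {A | collide A (fun i => x i) (fun i => y i)} := by
    refine Set.iUnion_subset fun i A hA => ?_
    have h1 := hA i
    simp only [S, if_true] at h1
    have h2 : ∀ j, j ≠ i → WithLp.toLp 2 (A j) ∈ F := fun j hj => by
      simpa only [S, if_neg hj] using hA j
    refine ⟨i, 1, Or.inl rfl, fun j hj => ?_, fun j hj => ?_⟩ <;>
      rw [mvMul_eq_inner, mvMul_eq_inner, one_mul]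
    · exact (not_le.1 fun h => h2 j hj (Or.inl h)).trans_le h1.1
    · exact (not_le.1 fun h => h2 j hj (Or.inr h)).trans_le h1.2
  refine le_trans ?_ (measureReal_mono (μ := gaussMatrix d d) hsub)
  rw [measureReal_iUnion_fintype hdisj hDm, mul_assoc]
  refine le_trans ?_ (Finset.card_nsmul_le_sum _ _ (q * 2⁻¹) fun i _ => hD i)
  simp

end Collision

lemma collProb_le_exp {R : ℝ} (hR : R ^ 2 < 4) :
    ∀ᶠ d : ℕ in Filter.atTop, ∀ x y : EuclideanSpace ℝ (Fin d), ‖x‖ = 1 → ‖y‖ = 1 → ‖x - y‖ = R →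
      collProb d (fun i => x i) (fun i => y i) ≤
        Real.exp (-(R ^ 2 / (4 - R ^ 2) * Real.log d) +
          (12 / (4 - R ^ 2) + 2) * Real.log (Real.log d)) := by
  have hL : Filter.Tendsto (fun d : ℕ => Real.log d) Filter.atTop Filter.atTop :=
    Real.tendsto_log_atTop.comp tendsto_natCast_atTop_atTop
  have hl := Real.tendsto_log_atTop.comp hL
  have hlo : ∀ᶠ L : ℝ in Filter.atTop, ‖Real.log L‖ ≤ 1 / 6 * ‖L‖ :=
    Real.isLittleO_log_id_atTop.bound (by norm_num)
  set α := R ^ 2 / (4 - R ^ 2) with hα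
  have hs : 0 < 4 - R ^ 2 := by linarith
  set κ := (√(2 * Real.pi))⁻¹ * Real.exp (-(3 / 2)) with hκ
  have hκ0 : 0 < κ := by positivity
  filter_upwards [Filter.eventually_ge_atTop 2, hL.eventually_ge_atTop 1,
    hL.eventually_ge_atTop (2 * α / κ), hl.eventually_ge_atTop 1, hL.eventually hlo]
    with d hd hL1 hL2 hl1 hlL x y hx hy hxy
  set L := Real.log d with hLd
  set l := Real.log L with hlL'
  change 1 ≤ l at hl1
  have hd0 : (0 : ℝ) < d := by positivity
  rw [Real.norm_of_nonneg (by linarith), Real.norm_of_nonneg (by linarith)] at hlL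
  set t := √(2 * L - 6 * l) with ht
  have ht2 : t ^ 2 = 2 * L - 6 * l := Real.sq_sqrt (by linarith)
  have ht1 : 1 ≤ t := Real.one_le_sqrt.2 (by linarith)
  have ht0 : 0 < t := by linarith
  have htL : t ≤ 2 * L := by nlinarith
  have hexpL : Real.exp L = d := Real.exp_log hd0
  have hexpl : Real.exp l = L := Real.exp_log (by linarith)
  refine (collProb_le hd hx hy hxy hR ht0).trans ?_
  have hinv : t⁻¹ ≤ 1 := inv_le_one_of_one_le₀ ht1
  have hinv0 : 0 < t⁻¹ := inv_pos.2 ht0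
  have hsq : (t + t⁻¹) ^ 2 ≤ t ^ 2 + 3 := by
    have : (t + t⁻¹) ^ 2 = t ^ 2 + 2 + t⁻¹ ^ 2 := by field_simp; ring
    nlinarith
  have h1 : α * L ≤ d * (t⁻¹ * ((√(2 * Real.pi))⁻¹ * Real.exp (-(t + t⁻¹) ^ 2 / 2))) := by
    have e1 : Real.exp (-(3 / 2)) * Real.exp (-L) * Real.exp l ^ 3 ≤
        Real.exp (-(t + t⁻¹) ^ 2 / 2) := by
      rw [← Real.exp_nat_mul, ← Real.exp_add, ← Real.exp_add]
      apply Real.exp_le_exp.2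
      push_cast
      linarith
    rw [Real.exp_neg L, hexpL, hexpl] at e1
    calc α * L ≤ κ * L ^ 2 / 2 := by
          rw [div_le_iff₀ hκ0] at hL2
          nlinarith
      _ = d * ((2 * L)⁻¹ * ((√(2 * Real.pi))⁻¹ *
            (Real.exp (-(3 / 2)) * (d : ℝ)⁻¹ * L ^ 3))) := by
          rw [hκ]; field_simp
      _ ≤ _ := by gcongr
  have h2 : d * (2 * Real.exp (-2 * t ^ 2 / (4 - R ^ 2))) =
      2 * Real.exp (-(α * L) + 12 / (4 - R ^ 2) * l) := by
    have : -(α * L) + 12 / (4 - R ^ 2) * l = L + -2 * t ^ 2 / (4 - R ^ 2) := by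
      rw [hα, ht2]; field_simp; ring
    rw [this, Real.exp_add, hexpL]; ring
  have h3 : Real.exp (-(d * (t⁻¹ * ((√(2 * Real.pi))⁻¹ * Real.exp (-(t + t⁻¹) ^ 2 / 2))))) ≤
      Real.exp (-(α * L) + 12 / (4 - R ^ 2) * l) := by
    apply Real.exp_le_exp.2
    have : 0 ≤ 12 / (4 - R ^ 2) * l := by positivity
    linarith
  rw [h2]
  have h4 : (4 : ℝ) ≤ Real.exp (2 * l) := by
    have := Real.add_one_le_exp l
    rw [two_mul, Real.exp_add]
    nlinarith
  rw [add_mul, ← add_assoc, Real.exp_add _ (2 * l)]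
  nlinarith [Real.exp_pos (-(α * L) + 12 / (4 - R ^ 2) * l)]

lemma exp_le_collProb {R : ℝ} (hR0 : 0 < R) (hR : R ^ 2 < 4) :
    ∀ᶠ d : ℕ in Filter.atTop, ∀ x y : EuclideanSpace ℝ (Fin d), ‖x‖ = 1 → ‖y‖ = 1 → ‖x - y‖ = R →
      Real.exp (-(R ^ 2 / (4 - R ^ 2) * Real.log d) - 2 * Real.log (Real.log d)) ≤
        collProb d (fun i => x i) (fun i => y i) := by
  have hL : Filter.Tendsto (fun d : ℕ => Real.log d) Filter.atTop Filter.atTop :=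
    Real.tendsto_log_atTop.comp tendsto_natCast_atTop_atTop
  have hl := Real.tendsto_log_atTop.comp hL
  set α := R ^ 2 / (4 - R ^ 2) with hα
  have hs2 : √(4 - R ^ 2) ^ 2 = 4 - R ^ 2 := Real.sq_sqrt (by linarith)
  have hs0 : 0 < √(4 - R ^ 2) := Real.sqrt_pos.2 (by linarith)
  set s := √(4 - R ^ 2) with hs
  set κ := ((√(2 * Real.pi))⁻¹) ^ 2 / 16 with hκ
  have hκ0 : 0 < κ := by positivity
  set M := (2 * (R + s) + (R + s) ^ 2 / 2 + 12) / s ^ 2 + 1 / 2 with hM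
  filter_upwards [Filter.eventually_ge_atTop 2, hL.eventually_ge_atTop 1,
    hl.eventually_ge_atTop (M - Real.log κ)] with d hd hL1 hl1 x y hx hy hxy
  set L := Real.log d with hLd
  set l := Real.log L with hlL'
  change M - Real.log κ ≤ l at hl1
  have hd0 : (0 : ℝ) < d := by positivity
  set t := √(2 * L + 6) with ht
  have ht2 : t ^ 2 = 2 * L + 6 := Real.sq_sqrt (by linarith)
  have ht1 : 1 ≤ t := Real.one_le_sqrt.2 (by linarith)
  have ht0 : 0 < t := by linarith
  have hexpL : Real.exp L = d := Real.exp_log hd0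
  have hexpl : Real.exp l = L := Real.exp_log (by linarith)
  have hexpκ : Real.exp (Real.log κ) = κ := Real.exp_log hκ0
  have hinv : t⁻¹ ≤ 1 := inv_le_one_of_one_le₀ ht1
  have hinv0 : 0 < t⁻¹ := inv_pos.2 ht0
  have hinv2 : t⁻¹ ^ 2 ≤ 1 := pow_le_one₀ hinv0.le hinv
  refine le_trans ?_ (le_collProb hx hy hxy hR0 hR ht0 ?_)
  · have hsq : ((2 * t + R * t⁻¹) / s + t⁻¹) ^ 2 ≤
        (4 * t ^ 2 + 4 * (R + s) + (R + s) ^ 2) / s ^ 2 := by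
      have : ((2 * t + R * t⁻¹) / s + t⁻¹) ^ 2 =
          (4 * t ^ 2 + 4 * (R + s) + (R + s) ^ 2 * t⁻¹ ^ 2) / s ^ 2 := by field_simp; ring
      rw [this]
      gcongr
      exact mul_le_of_le_one_right (sq_nonneg _) hinv2
    have e1 : Real.exp (-(4 * L / s ^ 2) - M) ≤
        Real.exp (-((2 * t + R * t⁻¹) / s + t⁻¹) ^ 2 / 2) * Real.exp (-(t⁻¹) ^ 2 / 2) := by
      rw [← Real.exp_add]
      apply Real.exp_le_exp.2
      have : -(4 * L / s ^ 2) - M =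
          -((4 * t ^ 2 + 4 * (R + s) + (R + s) ^ 2) / s ^ 2) / 2 + -1 / 2 := by
        rw [hM, ht2]; field_simp; ring
      rw [this]
      linarith
    have e2 : (8 * L)⁻¹ ≤ t⁻¹ * t⁻¹ := by
      rw [← mul_inv]
      exact inv_anti₀ (by positivity) (by nlinarith)
    calc Real.exp (-(α * L) - 2 * l)
        ≤ Real.exp (L + -l + Real.log κ + (-(4 * L / s ^ 2) - M)) := by
          apply Real.exp_le_exp.2
          have : -(α * L) = L - 4 * L / s ^ 2 := by
            rw [hα, ← hs2]
            have : R ^ 2 = 4 - s ^ 2 := by linarith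
            rw [this]; field_simp; ring
          linarith
      _ = d * ((8 * L)⁻¹ * ((√(2 * Real.pi))⁻¹ ^ 2 * Real.exp (-(4 * L / s ^ 2) - M))) * 2⁻¹ := by
          rw [Real.exp_add, Real.exp_add, Real.exp_add, Real.exp_neg l, hexpL, hexpl, hexpκ, hκ]
          field_simp; norm_num
      _ ≤ d * ((t⁻¹ * t⁻¹) * ((√(2 * Real.pi))⁻¹ ^ 2 *
            (Real.exp (-((2 * t + R * t⁻¹) / s + t⁻¹) ^ 2 / 2) *
              Real.exp (-(t⁻¹) ^ 2 / 2)))) * 2⁻¹ := by gcongr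
      _ = _ := by ring
  · have h8 : (8 : ℝ) ≤ Real.exp 3 := by
      have h2 : (2 : ℝ) ≤ Real.exp 1 := by linarith [Real.add_one_le_exp 1]
      have := pow_le_pow_left₀ (by norm_num) h2 3
      rw [← Real.exp_nat_mul] at this
      norm_num at this
      exact this
    have : -t ^ 2 / 2 = -(L + 3) := by rw [neg_div, ht2]; ring
    rw [this, Real.exp_neg, Real.exp_add, hexpL, ← div_eq_mul_inv, div_le_one (by positivity)]
    nlinarith

/-- Collision probability of cross-polytope LSH (Theorem 1 of Andoni–Indyk–Laarhoven–
Razenshteyn–Schmidt): for unit vectors at distance `R ∈ (0,2)`,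
`ln(1/Pr[h(x) = h(y)]) = R²/(4−R²)·ln d + O_R(ln ln d)`. -/
theorem stmt_11 (R : ℝ) (hR : 0 < R) (hR2 : R < 2) :
    ∃ C : ℝ, 0 < C ∧ ∃ d₀ : ℕ, ∀ d : ℕ, d₀ ≤ d →
      ∀ x y : EuclideanSpace ℝ (Fin d), ‖x‖ = 1 → ‖y‖ = 1 → ‖x - y‖ = R →
        |Real.log (1 / collProb d (fun i => x i) (fun i => y i)) -
            R ^ 2 / (4 - R ^ 2) * Real.log d|
          ≤ C * Real.log (Real.log d) := by
  have hR4 : R ^ 2 < 4 := by nlinarith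
  have hs : 0 < 4 - R ^ 2 := by linarith
  obtain ⟨d₀, h₀⟩ := Filter.eventually_atTop.1
    ((((Real.tendsto_log_atTop.comp Real.tendsto_log_atTop).comp
      tendsto_natCast_atTop_atTop).eventually_ge_atTop 0).and
      ((collProb_le_exp hR4).and (exp_le_collProb hR hR4)))
  refine ⟨12 / (4 - R ^ 2) + 2, by positivity, d₀, fun d hd x y hx hy hxy => ?_⟩
  obtain ⟨hl, hu, hlow⟩ := h₀ d hd
  replace hu := hu x y hx hy hxy
  replace hlow := hlow x y hx hy hxy
  change 0 ≤ Real.log (Real.log d) at hl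
  have hp := (Real.exp_pos _).trans_le hlow
  have h1 := (Real.log_le_iff_le_exp hp).2 hu
  have h2 := (Real.le_log_iff_exp_le hp).2 hlow
  have h3 : 0 ≤ 12 / (4 - R ^ 2) * Real.log (Real.log d) := by positivity
  rw [one_div, Real.log_inv, abs_le]
  constructor <;> linarith
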